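/- arXiv:2205.14750 — 3 statements merged into one kernel-verified Lean document; each statement's English description precedes it below -/
import Mathlib

section
/- Let P be a sharp, fine, saturated commutative monoid with P ≠ 0 (i.e. P has a nonzero element). Then there exists p ∈ P such that: (i) the only face of P containing p is P itself; and (ii) p is not a multiple of any other element of P, i.e. for every q ∈ P and every integer n ≥ 2 one has p ≠ n•q. -/
/-- A face of a commutative monoid `P` is a submonoid `F` such that `x + y ∈ F` implies
`x ∈ F` and `y ∈ F`. -/
def IsFace {P : Type*} [AddCommMonoid P] (F : AddSubmonoid P) : Prop :=
  ∀ x y : P, x + y ∈ F → x ∈ F ∧ y ∈ F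

/-- A commutative monoid is saturated if `n • a = n • b + c` (for some `c` and some `n ≥ 1`)
implies `a = b + d` for some `d`. -/
def IsSaturated (P : Type*) [AddCommMonoid P] : Prop :=
  ∀ a b : P, ∀ n : ℕ, 1 ≤ n → (∃ c : P, n • a = n • b + c) → ∃ d : P, a = b + d

/-- Let `P` be a sharp, fine (finitely generated and cancellative),
saturated commutative monoid with `P ≠ 0`.  Then there exists `p ∈ P` such that the only face
of `P` containing `p` is `P` itself, and `p` is not a multiple of any other element:
`p ≠ n • q` for every `q ∈ P` and every integer `n ≥ 2`. -/
theorem statement5 (P : Type*) [AddCommMonoid P] [IsCancelAdd P] [AddMonoid.FG P]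
    (hsat : IsSaturated P)
    (hsharp : ∀ u : P, IsAddUnit u → u = 0)
    (hne : ∃ p : P, p ≠ 0) :
    ∃ p : P, (∀ F : AddSubmonoid P, IsFace F → p ∈ F → F = ⊤) ∧
      ∀ (q : P) (n : ℕ), 2 ≤ n → p ≠ n • q := by
  classical
  obtain ⟨S, hS⟩ := (AddMonoid.FG.fg_top : (⊤ : AddSubmonoid P).FG)
  have hsurj : ∀ x : P, ∃ v : S → ℕ, ∑ i : S, v i • (i : P) = x := by
    intro x
    have hx : x ∈ AddSubmonoid.closure (S : Set P) := by rw [hS]; trivial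
    obtain ⟨f, -, hf⟩ := AddSubmonoid.mem_closure_finset.mp hx
    refine ⟨fun i => f i, ?_⟩
    rw [← hf]
    exact Finset.sum_coe_sort S (fun a => f a • a)
  have hwqo : ∀ x : ℕ → P, ∃ i j, i < j ∧ ∃ c, x j = x i + c := by
    intro x
    choose v hv using fun n => hsurj (x n)
    obtain ⟨i, j, hij, hle⟩ := wellQuasiOrdered_le v
    refine ⟨i, j, hij, ∑ s : S, (v j s - v i s) • (s : P), ?_⟩
    rw [← hv j, ← hv i, ← Finset.sum_add_distrib]
    refine Finset.sum_congr rfl fun s _ => ?_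
    rw [← add_nsmul]
    congr 1
    have : v i s ≤ v j s := hle s
    omega
  by_contra hcon
  push Not at hcon
  have hint0 : ¬ (∀ F : AddSubmonoid P, IsFace F → (0 : P) ∈ F → F = ⊤) := by
    intro h
    obtain ⟨p, hp⟩ := hne
    have h1 := h ⊥ (by
      intro x y hxy
      rw [AddSubmonoid.mem_bot] at hxy
      have hx : x = 0 := hsharp x (IsAddUnit.of_add_eq_zero y hxy)
      have hy : y = 0 := by simpa [hx] using hxy
      simp [hx, hy]) (by simp)
    have : p ∈ (⊥ : AddSubmonoid P) := by rw [h1]; trivial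
    exact hp (by simpa using this)
  have hstep : ∀ p : {p : P // ∀ F : AddSubmonoid P, IsFace F → p ∈ F → F = ⊤},
      ∃ q : {p : P // ∀ F : AddSubmonoid P, IsFace F → p ∈ F → F = ⊤},
        ∃ r : P, r ≠ 0 ∧ (p : P) = q + r := by
    rintro ⟨p, hp⟩
    obtain ⟨q, n, hn, rfl⟩ := hcon p hp
    have hq : ∀ F : AddSubmonoid P, IsFace F → q ∈ F → F = ⊤ :=
      fun F hF hqF => hp F hF (F.nsmul_mem hqF n)
    obtain ⟨m, rfl⟩ : ∃ m, n = m + 2 := ⟨n - 2, by omega⟩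
    refine ⟨⟨q, hq⟩, m • q + q, ?_, ?_⟩
    · intro h0
      have : q = 0 := hsharp q (IsAddUnit.of_add_eq_zero (m • q) (by rw [add_comm]; exact h0))
      exact hint0 (this ▸ hq)
    · simp only [add_nsmul, two_nsmul]
      abel
  have hs : ∀ F : AddSubmonoid P, IsFace F → (∑ i ∈ S, i) ∈ F → F = ⊤ := by
    intro F hF hsF
    rw [eq_top_iff, ← hS, AddSubmonoid.closure_le]
    intro i hi
    rw [← Finset.add_sum_erase S (fun i => i) hi] at hsF
    exact (hF _ _ hsF).1
  choose g r hr hg using hstep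
  let x : ℕ → {p : P // ∀ F : AddSubmonoid P, IsFace F → p ∈ F → F = ⊤} :=
    fun n => g^[n] ⟨_, hs⟩
  have hx : ∀ n, (x n : P) = x (n + 1) + r (x n) := by
    intro n
    have : x (n + 1) = g (x n) := Function.iterate_succ_apply' g n _
    rw [this]
    exact hg _
  have hdesc : ∀ i k, ∃ c, (x i : P) = x (i + 1 + k) + c + r (x i) := by
    intro i k
    induction k with
    | zero => exact ⟨0, by simpa using hx i⟩
    | succ k ih =>
      obtain ⟨c, hc⟩ := ih
      refine ⟨r (x (i + 1 + k)) + c, ?_⟩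
      rw [hx (i + 1 + k)] at hc
      rw [hc, ← add_assoc i.succ k 1]
      simp only [Nat.succ_eq_add_one, add_assoc]
  obtain ⟨i, j, hij, d, hd⟩ := hwqo (fun n => (x n : P))
  obtain ⟨k, rfl⟩ : ∃ k, j = i + 1 + k := ⟨j - (i + 1), by omega⟩
  obtain ⟨c, hc⟩ := hdesc i k
  rw [hd] at hc
  have h0 : r (x i) + (d + c) = 0 := by
    apply add_left_cancel (a := (x i : P))
    rw [add_zero]
    conv_rhs => rw [hc]
    abel
  exact hr (x i) (hsharp _ (IsAddUnit.of_add_eq_zero _ h0))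
end

section
/- Let P be a sharp, fine, saturated commutative monoid, K(P) its Grothendieck group with canonical injection ι : P → K(P), and let p ∈ P be an element such that the only face of P containing p is P itself, and such that p ≠ n•q for every q ∈ P and every integer n ≥ 2. Then the quotient group K(P)/ℤ•ι(p) is torsion-free; equivalently, for every x ∈ K(P) and every integer n ≥ 1, if n•x ∈ ℤ•ι(p) then x ∈ ℤ•ι(p). -/
/-- Let `P` be a sharp, fine, saturated commutative monoid with Grothendieck
group `K = K(P)` (encoded abstractly: `ι : P →+ K` is injective and every element of `K` is a
difference `ι a - ι b`).  Let `p ∈ P` be an element such that the only face of `P` containing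
`p` is `P` itself and such that `p ≠ n • q` for every `q ∈ P` and every `n ≥ 2`.  Then
`K(P)/ℤ•ι(p)` is torsion-free: for every `x ∈ K` and every `n ≥ 1`, if `n • x ∈ ℤ•ι(p)` then
`x ∈ ℤ•ι(p)`. -/
theorem statement6 (P : Type*) [AddCommMonoid P] [IsCancelAdd P] [AddMonoid.FG P]
    (hsat : IsSaturated P)
    (hsharp : ∀ u : P, IsAddUnit u → u = 0)
    (K : Type*) [AddCommGroup K] (ι : P →+ K) (hι : Function.Injective ι)
    (hK : ∀ x : K, ∃ a b : P, x = ι a - ι b)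
    (p : P)
    (hface : ∀ F : AddSubmonoid P, IsFace F → p ∈ F → F = ⊤)
    (hmult : ∀ (q : P) (n : ℕ), 2 ≤ n → p ≠ n • q) :
    ∀ x : K, ∀ n : ℕ, 1 ≤ n → n • x ∈ AddSubgroup.zmultiples (ι p) →
      x ∈ AddSubgroup.zmultiples (ι p) := by
  intro x n hn hx
  have htf : ∀ (z : K) (k : ℕ), 1 ≤ k → k • z = 0 → z = 0 := by
    intro z k hk hz
    obtain ⟨a, b, rfl⟩ := hK z
    have hab : k • a = k • b := by
      apply hι
      rw [map_nsmul, map_nsmul]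
      rwa [smul_sub, sub_eq_zero] at hz
    obtain ⟨d, hd⟩ := hsat a b k hk ⟨0, by rw [hab, add_zero]⟩
    obtain ⟨e, he⟩ := hsat b a k hk ⟨0, by rw [hab, add_zero]⟩
    have hde : d + e = 0 := by
      have h : b + (d + e) = b + 0 := by
        rw [← add_assoc, ← hd, ← he, add_zero]
      exact add_left_cancel h
    have hd0 : d = 0 := hsharp d (IsAddUnit.of_add_eq_zero e hde)
    rw [hd, hd0, add_zero, sub_self]
  obtain ⟨m, hm⟩ := AddSubgroup.mem_zmultiples_iff.1 hx
  obtain ⟨g, n', m', hg, hcop, hn', hm'⟩ : ∃ (g n' : ℕ) (m' : ℤ), 1 ≤ g ∧ IsCoprime (n' : ℤ) m' ∧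
      n = g * n' ∧ m = g * m' := by
    have hgpos : 0 < Int.gcd (n : ℤ) m := Int.gcd_pos_of_ne_zero_left _ (by omega)
    obtain ⟨a, ha⟩ := Int.gcd_dvd_left (n : ℤ) m
    obtain ⟨b, hb⟩ := Int.gcd_dvd_right (n : ℤ) m
    have hgz : (0 : ℤ) < (Int.gcd (n : ℤ) m : ℤ) := by exact_mod_cast hgpos
    have hapos : 0 ≤ a := by
      by_contra h
      push Not at h
      have := mul_neg_of_pos_of_neg hgz h
      omega
    lift a to ℕ using hapos
    refine ⟨Int.gcd (n : ℤ) m, a, b, hgpos, ?_, by exact_mod_cast ha, hb⟩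
    refine ⟨Int.gcdA n m, Int.gcdB n m, ?_⟩
    have h := Int.gcd_eq_gcd_ab (n : ℤ) m
    apply mul_left_cancel₀ hgz.ne'
    linear_combination (-1 : ℤ) * h - Int.gcdA n m * ha - Int.gcdB n m * hb
  have hx' : n' • x = m' • ι p := by
    rw [← sub_eq_zero]
    apply htf _ g hg
    rw [smul_sub, ← mul_smul, ← hn', ← hm, hm', mul_smul, natCast_zsmul, sub_self]
  obtain ⟨u, v, huv⟩ := hcop
  have hy : n' • (u • ι p + v • x) = ι p := by
    rw [← natCast_zsmul] at hx' ⊢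
    calc (n' : ℤ) • (u • ι p + v • x) = (u * n') • ι p + v • ((n' : ℤ) • x) := by module
      _ = (u * n' + v * m') • ι p := by rw [hx']; module
      _ = ι p := by rw [huv, one_smul]
  have hn1 : 1 ≤ n' := by
    rcases Nat.eq_zero_or_pos n' with h | h
    · subst h; omega
    · exact h
  obtain ⟨a, b, hab⟩ := hK (u • ι p + v • x)
  rw [hab] at hy
  have hab' : n' • a = n' • b + p := by
    apply hι
    rw [map_add, map_nsmul, map_nsmul, ← hy]
    module
  obtain ⟨d, hd⟩ := hsat a b n' hn1 ⟨p, hab'⟩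
  have hpd : p = n' • d := by
    rw [hd, smul_add] at hab'
    exact (add_left_cancel hab').symm
  have h1 : n' = 1 := by
    by_contra h
    exact hmult d n' (by omega) hpd
  rw [h1, one_smul] at hx'
  exact AddSubgroup.mem_zmultiples_iff.2 ⟨m', hx'.symm⟩
end

section
/- Let P be a sharp, fine, saturated commutative monoid with P ≠ 0. Then there exists a vertical monoid homomorphism θ : ℕ → P (i.e. the only face of P containing θ(1) is P itself) such that the cokernel of the induced homomorphism θ^gp : ℤ → K(P) of Grothendieck groups is torsion-free; equivalently, for every x ∈ K(P) and every integer n ≥ 1, if n•x ∈ ℤ•ι(θ(1)) then x ∈ ℤ•ι(θ(1)), where ι : P → K(P) is the canonical injection. -/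
/-- Let `P` be a sharp, fine, saturated commutative monoid with `P ≠ 0`, and
let `K = K(P)` be its Grothendieck group (encoded abstractly: `ι : P →+ K` is injective and
every element of `K` is a difference `ι a - ι b`).  Then there exists a vertical monoid
homomorphism `θ : ℕ → P` (i.e. the only face of `P` containing `θ 1` is `P` itself) such that
the cokernel of `θ^gp : ℤ → K(P)` is torsion-free: for every `x ∈ K` and every `n ≥ 1`, if
`n • x ∈ ℤ•ι(θ 1)` then `x ∈ ℤ•ι(θ 1)`. -/
theorem statement7 (P : Type*) [AddCommMonoid P] [IsCancelAdd P] [AddMonoid.FG P]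
    (hsat : IsSaturated P)
    (hsharp : ∀ u : P, IsAddUnit u → u = 0)
    (hne : ∃ p : P, p ≠ 0)
    (K : Type*) [AddCommGroup K] (ι : P →+ K) (hι : Function.Injective ι)
    (hK : ∀ x : K, ∃ a b : P, x = ι a - ι b) :
    ∃ θ : ℕ →+ P,
      (∀ F : AddSubmonoid P, IsFace F → θ 1 ∈ F → F = ⊤) ∧
      ∀ x : K, ∀ n : ℕ, 1 ≤ n → n • x ∈ AddSubgroup.zmultiples (ι (θ 1)) →
        x ∈ AddSubgroup.zmultiples (ι (θ 1)) := by
  classical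
  -- generators and their sum
  obtain ⟨S, hS⟩ := (AddMonoid.fg_def (M := P)).1 inferInstance
  set p : P := ∑ s ∈ S, s with hp
  have hface : ∀ F : AddSubmonoid P, IsFace F → p ∈ F → F = ⊤ := by
    intro F hF hpF
    rw [eq_top_iff, ← hS, AddSubmonoid.closure_le]
    intro s hs
    have : s + ∑ t ∈ S.erase s, t = p := Finset.add_sum_erase S (fun t => t) hs
    exact (hF s _ (this ▸ hpF)).1
  have hunit : ∀ d e : P, d + e = 0 → d = 0 := fun d e h =>
    hsharp d (IsAddUnit.of_add_eq_zero e h)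
  have hp0 : p ≠ 0 := by
    intro h
    have hb : IsFace (⊥ : AddSubmonoid P) := by
      intro x y hxy
      rw [AddSubmonoid.mem_bot] at hxy
      simp only [AddSubmonoid.mem_bot]
      exact ⟨hunit x y hxy, hunit y x (by rw [add_comm]; exact hxy)⟩
    have ht := hface ⊥ hb (by rw [h]; exact zero_mem _)
    obtain ⟨q, hq⟩ := hne
    have : q ∈ (⊥ : AddSubmonoid P) := by rw [ht]; trivial
    exact hq (AddSubmonoid.mem_bot.1 this)
  have hpos : ∀ (n : ℕ) (q : K), 1 ≤ n → ∀ r : P, n • q = ι r → ∃ d : P, q = ι d := by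
    intro n q hn r h
    obtain ⟨a, b, rfl⟩ := hK q
    have h1 : n • a = n • b + r := by
      apply hι
      rw [map_add, map_nsmul, map_nsmul, ← h, smul_sub]
      abel
    obtain ⟨d, hd⟩ := hsat a b n hn ⟨r, h1⟩
    exact ⟨d, by rw [hd, map_add]; abel⟩
  have htor : ∀ (n : ℕ) (x : K), 1 ≤ n → n • x = 0 → x = 0 := by
    intro n x hn h
    obtain ⟨d, hd⟩ := hpos n x hn 0 (by rw [h, map_zero])
    obtain ⟨e, he⟩ := hpos n (-x) hn 0 (by rw [smul_neg, h, map_zero, neg_zero])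
    have : d + e = 0 := hι (by rw [map_add, ← hd, ← he, map_zero]; abel)
    rw [hd, hunit d e this, map_zero]
  have htf : IsAddTorsionFree K := by
    refine ⟨fun n hn x y hxy => ?_⟩
    have := htor n (x - y) (by lia) (by rw [smul_sub]; exact sub_eq_zero.2 hxy)
    exact sub_eq_zero.1 this
  have hfin : Module.Finite ℤ K := by
    rw [Module.Finite.iff_addGroup_fg, AddGroup.fg_iff]
    refine ⟨ι '' S, ?_, S.finite_toSet.image _⟩
    have hm : ∀ a : P, ι a ∈ AddSubgroup.closure (ι '' (S : Set P)) := by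
      intro a
      have : (⊤ : AddSubmonoid P) ≤
          (AddSubgroup.closure (ι '' (S : Set P))).toAddSubmonoid.comap ι := by
        rw [← hS, AddSubmonoid.closure_le]
        intro s hs
        exact AddSubgroup.subset_closure ⟨s, hs, rfl⟩
      exact this trivial
    rw [eq_top_iff]
    intro x _
    obtain ⟨a, b, rfl⟩ := hK x
    exact sub_mem (hm a) (hm b)
  have hfree : Module.Free ℤ K := inferInstance
  have hp0' : ι p ≠ 0 := fun h => hp0 (hι (by rw [h, map_zero]))
  obtain ⟨l, hl⟩ : ∃ l : K →ₗ[ℤ] ℤ, l (ι p) ≠ 0 := by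
    by_contra! h
    exact hp0' ((Module.Free.chooseBasis ℤ K).forall_coord_eq_zero_iff.1 fun i => h _)
  let T : Set ℕ := {m | ∃ q : K, m • q = ι p}
  have hTb : BddAbove T := by
    refine ⟨(l (ι p)).natAbs, ?_⟩
    rintro m ⟨q, hq⟩
    have : (m : ℤ) ∣ l (ι p) := ⟨l q, by rw [← hq, map_nsmul, nsmul_eq_mul]⟩
    exact Nat.le_of_dvd (Int.natAbs_pos.2 hl) (Int.natCast_dvd.1 this)
  have hTn : T.Nonempty := ⟨1, ι p, one_smul _ _⟩
  obtain ⟨q, hq⟩ := Nat.sSup_mem hTn hTb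
  set m := sSup T with hm
  have hmax : ∀ k ∈ T, k ≤ m := fun k hk => le_csSup hTb hk
  have hm1 : 1 ≤ m := hmax 1 ⟨ι p, one_smul _ _⟩
  obtain ⟨d, rfl⟩ := hpos m q hm1 p hq
  have hd : m • d = p := hι (by rw [map_nsmul, hq])
  refine ⟨multiplesHom P d, ?_, ?_⟩
  · intro F hF hdF
    refine hface F hF (hd ▸ nsmul_mem ?_ m)
    simpa using hdF
  · intro x n hn hx
    have h1 : multiplesHom P d 1 = d := by simp
    rw [h1] at hx ⊢
    obtain ⟨k, hk⟩ := AddSubgroup.mem_zmultiples_iff.1 hx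
    have hg0 : 0 < Int.gcd n k := Int.gcd_pos_of_ne_zero_left _ (by lia)
    obtain ⟨n', k', hcop, hn', hk'⟩ := Int.exists_gcd_one hg0
    set g := Int.gcd n k with hg
    have hx' : n' • x = k' • ι d := by
      rw [← sub_eq_zero]
      apply htor g _ hg0
      rw [smul_sub, sub_eq_zero, ← natCast_zsmul, ← natCast_zsmul, smul_smul, smul_smul,
        mul_comm _ n', mul_comm _ k', ← hn', ← hk', natCast_zsmul, hk]
    have hn'pos : 0 < n' := by
      have h2 : (0 : ℤ) < n' * g := by rw [← hn']; lia
      exact pos_of_mul_pos_left h2 (by positivity)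
    obtain ⟨u, v, huv⟩ := Int.isCoprime_iff_gcd_eq_one.2 hcop
    have hy : n' • (u • ι d + v • x) = ι d := by
      calc n' • (u • ι d + v • x) = (u * n') • ι d + v • (n' • x) := by module
        _ = (u * n' + v * k') • ι d := by rw [hx']; module
        _ = ι d := by rw [huv, one_smul]
    lift n' to ℕ using hn'pos.le
    have hT : m * n' ∈ T := ⟨u • ι d + v • x, by
      rw [mul_smul, ← natCast_zsmul _ n', hy, hq]⟩
    have h3 := hmax _ hT
    have h4 : n' = 1 := by
      have : 0 < n' := by exact_mod_cast hn'pos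
      have : n' ≤ 1 := Nat.le_of_mul_le_mul_left (by simpa using h3) hm1
      lia
    rw [AddSubgroup.mem_zmultiples_iff]
    exact ⟨k', by rw [← hx', h4]; simp⟩
end
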